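/- Let R be an extension of a non-trivial finite group G by a two-element set T = {t₁, t₂}. Then R is a commutative fusion ring if and only if G is a commutative group. -/

import Mathlib

/-- A fusion ring, given by its finite basis `B`, unit, involution (dual) and
structure constants `N a b c` (the coefficient of `c` in `a × b`). -/
structure FusionData (B : Type*) [Fintype B] [DecidableEq B] where
  one : B
  dual : B → B
  N : B → B → B → ℕ
  dual_dual : ∀ a, dual (dual a) = a
  N_one_left : ∀ a c, N one a c = if a = c then 1 else 0
  N_one_right : ∀ a c, N a one c = if a = c then 1 else 0
  assoc : ∀ a b c d, ∑ e, N a b e * N e c d = ∑ f, N b c f * N a f d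
  dual_pair : ∀ a b, N a (dual b) one = if a = b then 1 else 0
  frob : ∀ a b c, N a b c = N (dual a) c b

/-- An extension of a finite group `G` by a finite set `T`: a fusion ring with
basis `G ⊔ T`, unit `1 ∈ G`, whose structure constants restrict to the group
multiplication on `G`. -/
structure GroupExt (G T : Type*) [Group G] [Fintype G] [DecidableEq G]
    [Fintype T] [DecidableEq T] extends FusionData (G ⊕ T) where
  one_def : one = Sum.inl 1
  mul_def : ∀ g h k : G, N (Sum.inl g) (Sum.inl h) (Sum.inl k) = if g * h = k then 1 else 0
  mul_t : ∀ (g h : G) (t : T), N (Sum.inl g) (Sum.inl h) (Sum.inr t) = 0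

namespace FusionData

variable {B : Type*} [Fintype B] [DecidableEq B] (F : FusionData B)

theorem N_eq_one (a b : B) : F.N a b F.one = if a = F.dual b then 1 else 0 := by
  have h := F.dual_pair a (F.dual b)
  rwa [F.dual_dual] at h

theorem eq_dual_comm (a b : B) : a = F.dual b ↔ b = F.dual a := by
  constructor <;> rintro rfl <;> rw [F.dual_dual]

/-- Cyclic invariance of the coefficient of the unit in a triple product. -/
theorem N_cyclic (a b c : B) : F.N a b (F.dual c) = F.N b c (F.dual a) := by
  have h := F.assoc a b c F.one
  simp only [N_eq_one] at h
  simpa [F.eq_dual_comm a] using h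

end FusionData

namespace GroupExt

variable {G T : Type*} [Group G] [Fintype G] [DecidableEq G] [Fintype T] [DecidableEq T]
  (E : GroupExt G T)

theorem dual_inl (g : G) : E.dual (Sum.inl g) = Sum.inl g⁻¹ := by
  have h := E.N_eq_one (Sum.inl g⁻¹) (Sum.inl g)
  rw [E.one_def, E.mul_def] at h
  by_contra hne
  simp [Ne.symm hne] at h

theorem exists_dual_inr (t : T) : ∃ s : T, E.dual (Sum.inr t) = Sum.inr s := by
  rcases h : E.dual (Sum.inr t) with g | s
  · have h' := E.dual_dual (Sum.inr t)
    rw [h, dual_inl] at h'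
    simp at h'
  · exact ⟨s, rfl⟩

theorem N_inl_inl_dual_inr (g h : G) (t : T) :
    E.N (Sum.inl g) (Sum.inl h) (E.dual (Sum.inr t)) = 0 := by
  obtain ⟨s, hs⟩ := E.exists_dual_inr t
  rw [hs, E.mul_t]

theorem N_inl_inr_inl (g k : G) (t : T) : E.N (Sum.inl g) (Sum.inr t) (Sum.inl k) = 0 := by
  rw [E.frob, dual_inl, E.mul_t]

/-- Left multiplication by a group element acts on the remaining basis elements by an
orthogonal matrix. -/
theorem sum_N_mul_N (g : G) (t d : T) :
    ∑ s : T, E.N (Sum.inl g) (Sum.inr s) (Sum.inr t) * E.N (Sum.inl g) (Sum.inr s) (Sum.inr d) =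
      if t = d then 1 else 0 := by
  have h := E.assoc (Sum.inl g) (Sum.inl g⁻¹) (Sum.inr t) (Sum.inr d)
  have h1 := E.N_one_left (Sum.inr t) (Sum.inr d)
  rw [E.one_def] at h1
  simp only [Fintype.sum_sum_type, E.mul_def, E.mul_t, N_inl_inr_inl] at h
  simp [h1] at h
  rw [h]
  refine Finset.sum_congr rfl fun s _ => ?_
  rw [E.frob (Sum.inl g⁻¹), dual_inl, inv_inv]

theorem N_inl_inr_eq {x y : T} (hxy : x ≠ y) (hT : (Finset.univ : Finset T) = {x, y}) (g : G) :
    E.N (Sum.inl g) (Sum.inr x) (Sum.inr x) = E.N (Sum.inl g) (Sum.inr y) (Sum.inr y) ∧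
    E.N (Sum.inl g) (Sum.inr x) (Sum.inr y) = E.N (Sum.inl g) (Sum.inr y) (Sum.inr x) := by
  have hxx := E.sum_N_mul_N g x x
  have hxy' := E.sum_N_mul_N g x y
  have hyy := E.sum_N_mul_N g y y
  simp only [hT, Finset.sum_pair hxy, if_true, if_neg hxy] at hxx hxy' hyy
  generalize E.N (Sum.inl g) (Sum.inr x) (Sum.inr x) = a at *
  generalize E.N (Sum.inl g) (Sum.inr x) (Sum.inr y) = b at *
  generalize E.N (Sum.inl g) (Sum.inr y) (Sum.inr x) = c at *
  generalize E.N (Sum.inl g) (Sum.inr y) (Sum.inr y) = d at *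
  have ha : a ≤ 1 := by nlinarith
  have hb : b ≤ 1 := by nlinarith
  have hc : c ≤ 1 := by nlinarith
  have hd : d ≤ 1 := by nlinarith
  interval_cases a <;> interval_cases b <;> interval_cases c <;> interval_cases d <;> simp_all

theorem N_inl_inr_dual_inr_symm (hT : Fintype.card T = 2) (g : G) (t s : T) :
    E.N (Sum.inl g) (Sum.inr t) (E.dual (Sum.inr s)) =
      E.N (Sum.inl g) (Sum.inr s) (E.dual (Sum.inr t)) := by
  obtain ⟨x, y, hxy, hu⟩ := Finset.card_eq_two.1 ((Finset.card_univ (α := T)).trans hT)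
  have hmem : ∀ z : T, z = x ∨ z = y := fun z => by
    have := Finset.mem_univ z
    rw [hu] at this
    simpa using this
  obtain ⟨h1, h2⟩ := E.N_inl_inr_eq hxy hu g
  obtain ⟨x', hx⟩ := E.exists_dual_inr x
  obtain ⟨y', hy⟩ := E.exists_dual_inr y
  have hne : x' ≠ y' := by
    rintro rfl
    have := congrArg E.dual (hx.trans hy.symm)
    rw [E.dual_dual, E.dual_dual] at this
    exact hxy (Sum.inr_injective this)
  rcases hmem t with rfl | rfl <;> rcases hmem s with rfl | rfl <;>
    rcases hmem x' with rfl | rfl <;> rcases hmem y' with rfl | rfl <;> simp_all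

theorem N_inr_inr_dual_inr_comm (hT : Fintype.card T = 2) (t s u : T) :
    E.N (Sum.inr t) (Sum.inr s) (E.dual (Sum.inr u)) =
      E.N (Sum.inr s) (Sum.inr t) (E.dual (Sum.inr u)) := by
  have h : t = s ∨ s = u ∨ u = t := by
    by_contra! h
    have := Finset.card_le_univ ({t, s, u} : Finset T)
    rw [hT, Finset.card_eq_three.2 ⟨t, s, u, h.1, h.2.2.symm, h.2.1, rfl⟩] at this
    omega
  rcases h with rfl | rfl | rfl
  · rfl
  · exact (E.N_cyclic _ _ _).symm
  · exact E.N_cyclic _ _ _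

theorem N_dual_comm (hT : Fintype.card T = 2) (hG : ∀ g h : G, g * h = h * g) (a b c : G ⊕ T) :
    E.N a b (E.dual c) = E.N b a (E.dual c) := by
  rcases a with g | t <;> rcases b with h | s <;> rcases c with k | u
  · rw [dual_inl, E.mul_def, E.mul_def, hG]
  · rw [N_inl_inl_dual_inr, N_inl_inl_dual_inr]
  · rw [← E.N_cyclic (Sum.inl k), E.N_cyclic (Sum.inr s), N_inl_inl_dual_inr, N_inl_inl_dual_inr]
  · rw [E.N_cyclic (Sum.inr s), E.N_inl_inr_dual_inr_symm hT]
  · rw [E.N_cyclic (Sum.inr t), ← E.N_cyclic (Sum.inl k), N_inl_inl_dual_inr, N_inl_inl_dual_inr]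
  · rw [E.N_cyclic (Sum.inr t), E.N_inl_inr_dual_inr_symm hT]
  · rw [← E.N_cyclic (Sum.inl k), ← E.N_cyclic (Sum.inl k), E.N_inl_inr_dual_inr_symm hT]
  · exact E.N_inr_inr_dual_inr_comm hT t s u

end GroupExt

/-- An extension of a non-trivial finite group `G` by a two-element
set `T` is a commutative fusion ring iff `G` is a commutative group. -/
theorem two_particle_comm_iff {G T : Type*} [Group G] [Fintype G] [DecidableEq G]
    [Fintype T] [DecidableEq T] [Nonempty T] [Nontrivial G]
    (hT : Fintype.card T = 2) (E : GroupExt G T) :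
    (∀ a b c : G ⊕ T, E.N a b c = E.N b a c) ↔ (∀ g h : G, g * h = h * g) := by
  constructor
  · intro hE g h
    have hgh := hE (Sum.inl g) (Sum.inl h) (Sum.inl (h * g))
    rw [E.mul_def, E.mul_def, if_pos rfl] at hgh
    by_contra hne
    simp [hne] at hgh
  · intro hG a b c
    have h := E.N_dual_comm hT hG a b (E.dual c)
    rwa [E.dual_dual] at h
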